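/- Let G be a finite group. If for every prime p dividing |G| and every non-cyclic Sylow p-subgroup P of G, every maximal subgroup of P is S-quasinormal in G, then G is supersoluble. -/

import Mathlib

open scoped Pointwise

/-- A group `G` is `p`-nilpotent if it has a normal `p`-complement, i.e. a normal
subgroup `N` whose order is not divisible by `p` and whose index is a power of `p`. -/
def IsPNilpotent (p : ℕ) (G : Type*) [Group G] : Prop :=
  ∃ N : Subgroup G, N.Normal ∧ ¬ p ∣ Nat.card N ∧ ∃ k : ℕ, N.index = p ^ k

/-- A subgroup `H` of `G` is c-normal in `G` if there is a normal subgroup `T`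
with `G = HT` and `H ⊓ T` contained in the normal core of `H`. -/
def Subgroup.IsCNormal {G : Type*} [Group G] (H : Subgroup G) : Prop :=
  ∃ T : Subgroup G, T.Normal ∧ (H : Set G) * (T : Set G) = Set.univ ∧ H ⊓ T ≤ H.normalCore

/-- A subgroup `H` of `G` is S-quasinormal in `G` if it permutes with every Sylow
subgroup of `G`. -/
def Subgroup.IsSQuasinormal {G : Type*} [Group G] (H : Subgroup G) : Prop :=
  ∀ q : ℕ, q.Prime → ∀ Q : Sylow q G,
    (H : Set G) * ((Q : Subgroup G) : Set G) = ((Q : Subgroup G) : Set G) * (H : Set G)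

/-- A subgroup `H` of `G` has a `p`-nilpotent supplement in `G` if there is a
subgroup `K` with `G = HK` and `K` `p`-nilpotent. -/
def HasPNilpotentSupplement (p : ℕ) {G : Type*} [Group G] (H : Subgroup G) : Prop :=
  ∃ K : Subgroup G, (H : Set G) * (K : Set G) = Set.univ ∧ IsPNilpotent p K

/-- `M` is a maximal (proper) subgroup of `P`. -/
def IsMaximalSubgroupOf {G : Type*} [Group G] (M P : Subgroup G) : Prop :=
  M < P ∧ ∀ K : Subgroup G, M < K → K ≤ P → K = P

/-- `P` is a Sylow `p`-subgroup of the subgroup `E`: a maximal `p`-subgroup of `E`. -/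
def IsSylowSubgroupOf (p : ℕ) {G : Type*} [Group G] (P E : Subgroup G) : Prop :=
  P ≤ E ∧ IsPGroup p P ∧ ∀ Q : Subgroup G, Q ≤ E → IsPGroup p Q → P ≤ Q → Q = P

/-- A group is supersolvable if it has a chain of subgroups from `⊥` to `⊤`,
each normal in `G`, in which each successive quotient is cyclic (i.e. each step
is generated by the previous one together with a single element). -/
def IsSupersolvable (G : Type*) [Group G] : Prop :=
  ∃ (n : ℕ) (c : ℕ → Subgroup G), c 0 = ⊥ ∧ c n = ⊤ ∧
    (∀ i, c i ≤ c (i + 1)) ∧ (∀ i, (c i).Normal) ∧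
    ∀ i, ∃ x ∈ c (i + 1), c i ⊔ Subgroup.zpowers x = c (i + 1)


namespace SQ

/-- `H = ⊤` as soon as it contains a Sylow subgroup for each prime. -/
theorem eq_top_of_sylow {G : Type*} [Group G] [Finite G] (H : Subgroup G)
    (h : ∀ q : ℕ, q.Prime → ∃ Q : Sylow q G, (Q : Subgroup G) ≤ H) : H = ⊤ := by
  rw [← Subgroup.index_eq_one]
  by_contra hne
  obtain ⟨q, hq, hd⟩ := Nat.exists_prime_and_dvd hne
  have := Fact.mk hq
  obtain ⟨Q, hQ⟩ := h q hq
  exact Q.not_dvd_index (hd.trans (Subgroup.index_dvd_of_le hQ))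

/-- The product of two permuting subgroups is a subgroup of order dividing the product. -/
theorem exists_prod {G : Type*} [Group G] [Finite G] (A B : Subgroup G)
    (h : (A : Set G) * (B : Set G) = (B : Set G) * (A : Set G)) :
    ∃ T : Subgroup G, A ≤ T ∧ B ≤ T ∧ Nat.card T ∣ Nat.card A * Nat.card B := by
  let T : Subgroup G :=
    { carrier := (A : Set G) * (B : Set G)
      mul_mem' := by
        intro x y hx hy
        have e : ((A : Set G) * B) * ((A : Set G) * B) = (A : Set G) * B := by
          rw [mul_assoc, ← mul_assoc (B : Set G), ← h, mul_assoc, ← mul_assoc,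
            coe_mul_coe, coe_mul_coe]
        rw [← e]
        exact Set.mul_mem_mul hx hy
      one_mem' := ⟨1, A.one_mem, 1, B.one_mem, by simp⟩
      inv_mem' := by
        rintro x ⟨a, ha, b, hb, rfl⟩
        change (a * b)⁻¹ ∈ (A : Set G) * (B : Set G)
        rw [h]
        exact ⟨b⁻¹, B.inv_mem hb, a⁻¹, A.inv_mem ha, by simp⟩ }
  refine ⟨T, fun a ha => ⟨a, ha, 1, B.one_mem, by simp⟩,
    fun b hb => ⟨1, A.one_mem, b, hb, by simp⟩, ?_⟩
  have h1 : Nat.card T = Nat.card B * Nat.card (((A : Set G).image (↑) : Set (G ⧸ B))) :=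
    Subgroup.card_mul_eq_card_subgroup_mul_card_quotient B (A : Set G)
  have h2 : ((A : Set G).image (↑) : Set (G ⧸ B)) = MulAction.orbit A ((1 : G) : G ⧸ B) := by
    ext z
    constructor
    · rintro ⟨a, ha, rfl⟩
      exact ⟨⟨a, ha⟩, congrArg _ (mul_one a)⟩
    · rintro ⟨⟨a, ha⟩, rfl⟩
      exact ⟨a, ha, (congrArg _ (mul_one a)).symm⟩
  rw [h1, h2, mul_comm]
  refine Nat.mul_dvd_mul ?_ dvd_rfl
  rw [Nat.card_congr (MulAction.orbitEquivQuotientStabilizer A ((1 : G) : G ⧸ B))]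
  exact Subgroup.card_quotient_dvd_card _

/-- A maximal subgroup of `P` is the image of a coatom. -/
theorem coatom_of_max {G : Type*} [Group G] {M P : Subgroup G} (h : IsMaximalSubgroupOf M P) :
    IsCoatom (M.subgroupOf P) := by
  refine ⟨fun e => h.1.not_ge (Subgroup.subgroupOf_eq_top.1 e), fun K hK => ?_⟩
  have h1 : M < K.map P.subtype := by
    refine lt_of_le_of_ne ?_ ?_
    · rw [← Subgroup.map_subgroupOf_eq_of_le h.1.le]
      exact Subgroup.map_mono hK.le
    · rintro rfl
      apply hK.ne
      ext x
      simp [Subgroup.mem_subgroupOf]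
  have h2 := h.2 _ h1 (Subgroup.map_subtype_le K)
  rw [eq_top_iff]
  intro x _
  have : (x : G) ∈ K.map P.subtype := h2.ge x.2
  simpa using this

/-- A proper subgroup of `P` lies in a maximal subgroup. -/
theorem exists_max {G : Type*} [Group G] [Finite G] {H P : Subgroup G} (h : H < P) :
    ∃ M, IsMaximalSubgroupOf M P ∧ H ≤ M := by
  obtain ⟨M, ⟨hM, hHM⟩, hmax⟩ := Set.Finite.exists_maximalFor id {M : Subgroup G | M < P ∧ H ≤ M}
    (Set.toFinite _) ⟨H, h, le_rfl⟩
  refine ⟨M, ⟨hM, fun K hK hKP => ?_⟩, hHM⟩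
  by_contra hne
  exact hK.not_ge (hmax ⟨lt_of_le_of_ne hKP hne, hHM.trans hK.le⟩ hK.le)

theorem max_normal {G : Type*} [Group G] [Finite G] {p : ℕ} [Fact p.Prime] {M P : Subgroup G}
    (hP : IsPGroup p P) (h : IsMaximalSubgroupOf M P) : P ≤ Subgroup.normalizer M := by
  have := hP.isNilpotent
  have : (M.subgroupOf P).Normal := Subgroup.NormalizerCondition.normal_of_coatom _
    (Group.normalizerCondition_of_isNilpotent) (coatom_of_max h)
  exact (Subgroup.normal_subgroupOf_iff_le_normalizer h.1.le).1 this

theorem max_card {G : Type*} [Group G] [Finite G] {p : ℕ} [Fact p.Prime] {M P : Subgroup G}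
    (hP : IsPGroup p P) (h : IsMaximalSubgroupOf M P) : Nat.card P = Nat.card M * p := by
  obtain ⟨n, hn⟩ := IsPGroup.iff_card.1 (hP.to_le h.1.le)
  obtain ⟨m, hm⟩ := IsPGroup.iff_card.1 hP
  have hlt : Nat.card M < Nat.card P := by
    refine lt_of_le_of_ne (Nat.card_mono (Set.toFinite _) h.1.le) fun e => h.1.ne ?_
    exact Subgroup.eq_of_le_of_card_ge h.1.le e.ge
  have hnm : n < m := by
    rw [hn, hm] at hlt
    exact (Nat.pow_lt_pow_iff_right (Fact.out : p.Prime).one_lt).1 hlt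
  have hc : Nat.card (M.subgroupOf P) = p ^ n := by
    rw [← hn]; exact Nat.card_congr (Subgroup.subgroupOfEquivOfLe h.1.le).toEquiv
  obtain ⟨K, hK, hMK⟩ := Sylow.exists_subgroup_card_pow_succ (G := P) (p := p) (n := n)
    (hm ▸ pow_dvd_pow p hnm) hc
  have : M.subgroupOf P < K := lt_of_le_of_ne hMK (by
    rintro rfl
    rw [hc] at hK
    exact absurd (Nat.pow_right_injective (Fact.out : p.Prime).two_le hK) (by omega))
  have := (coatom_of_max h).2 K this
  subst this
  rw [Subgroup.card_top] at hK
  rw [hK, hn, pow_succ]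

/-- the hypothesis carried through the induction -/
def Hyp (G : Type*) [Group G] : Prop :=
  ∀ p : ℕ, p.Prime → ∀ P : Sylow p G, IsCyclic P ∨
    ((P : Subgroup G).Normal ∧ ∀ M : Subgroup G, IsMaximalSubgroupOf M P → M.Normal)

theorem sq_le {G : Type*} [Group G] [Finite G] {p : ℕ} [Fact p.Prime] {M : Subgroup G}
    (hM : IsPGroup p M) (h : M.IsSQuasinormal) (P : Sylow p G) : M ≤ P := by
  obtain ⟨T, h1, h2, h3⟩ := exists_prod M P (h p Fact.out P)
  obtain ⟨n, hn⟩ := IsPGroup.iff_card.1 hM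
  obtain ⟨m, hm⟩ := IsPGroup.iff_card.1 P.2
  rw [hn, hm, ← pow_add] at h3
  obtain ⟨k, -, hk⟩ := (Nat.dvd_prime_pow Fact.out).1 h3
  rwa [P.3 (IsPGroup.of_card hk) h2] at h1

theorem hyp_of {G : Type*} [Group G] [Finite G]
    (h : ∀ p : ℕ, p.Prime → p ∣ Nat.card G → ∀ P : Sylow p G,
      ¬ IsCyclic (P : Subgroup G) →
      ∀ M : Subgroup G, IsMaximalSubgroupOf M (P : Subgroup G) → M.IsSQuasinormal) :
    Hyp G := by
  intro p hp P
  have := Fact.mk hp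
  by_cases hc : IsCyclic P
  · exact Or.inl hc
  right
  have hd : p ∣ Nat.card G := by
    by_contra hd
    apply hc
    have : Nat.card P = 1 := by
      obtain ⟨m, hm⟩ := IsPGroup.iff_card.1 P.2
      rcases Nat.eq_zero_or_pos m with rfl | hm0
      · simpa using hm
      · exact absurd (((dvd_pow_self p hm0.ne').trans hm.symm.dvd).trans
          (Subgroup.card_subgroup_dvd_card _)) hd
    have := (Nat.card_eq_one_iff_unique.1 this).1
    infer_instance
  have h := h p hp hd P hc
  have hle : ∀ P' : Sylow p G, (P : Subgroup G) ≤ P' := by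
    intro P' y hy
    have hlt : Subgroup.zpowers y < P := by
      refine lt_of_le_of_ne (Subgroup.zpowers_le.2 hy) fun e => hc ?_
      change IsCyclic (P : Subgroup G)
      rw [← e]
      infer_instance
    obtain ⟨M, hM, hyM⟩ := exists_max hlt
    exact sq_le (P.2.to_le hM.1.le) (h M hM) P' (hyM (Subgroup.mem_zpowers y))
  have hPn : (P : Subgroup G).Normal := by
    constructor
    intro n hn g
    have := hle (g⁻¹ • P) hn
    rw [Sylow.coe_subgroup_smul, Subgroup.mem_pointwise_smul_iff_inv_smul_mem] at this
    simpa using this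
  refine ⟨hPn, fun M hM => ?_⟩
  rw [← Subgroup.normalizer_eq_top_iff]
  apply eq_top_of_sylow
  intro q hq
  have := Fact.mk hq
  by_cases hqp : q = p
  · subst hqp
    exact ⟨P, max_normal P.2 hM⟩
  obtain ⟨Q⟩ : Nonempty (Sylow q G) := inferInstance
  refine ⟨Q, ?_⟩
  obtain ⟨T, h1, h2, h3⟩ := exists_prod M Q (h M hM q hq Q)
  have hTM : M = T ⊓ P := by
    refine Subgroup.eq_of_le_of_card_ge (le_inf h1 hM.1.le) (Nat.le_of_dvd Nat.card_pos ?_)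
    obtain ⟨n, hn⟩ := IsPGroup.iff_card.1 (P.2.to_le (inf_le_right : T ⊓ (P : Subgroup G) ≤ P))
    obtain ⟨m, hm⟩ := IsPGroup.iff_card.1 Q.2
    have hcop : Nat.Coprime (Nat.card (T ⊓ (P : Subgroup G) : Subgroup G)) (Nat.card Q) := by
      rw [hn]
      change Nat.Coprime _ (Nat.card (Q : Subgroup G))
      rw [hm]
      exact Nat.Coprime.pow _ _ ((Nat.coprime_primes hp hq).2 (Ne.symm hqp))
    exact hcop.dvd_of_dvd_mul_right ((Subgroup.card_dvd_of_le inf_le_left).trans h3)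
  intro x hx
  have key : ∀ x ∈ Q, ∀ z ∈ M, x * z * x⁻¹ ∈ M := by
    intro x hx z hz
    rw [hTM] at hz ⊢
    exact ⟨T.mul_mem (T.mul_mem (h2 hx) hz.1) (T.inv_mem (h2 hx)), hPn.conj_mem z hz.2 x⟩
  rw [Subgroup.mem_normalizer_iff]
  intro z
  refine ⟨key x hx z, fun hz => ?_⟩
  have := key x⁻¹ (inv_mem hx) _ hz
  simpa [mul_assoc] using this

theorem hyp_quot {G : Type*} [Group G] [Finite G] (h : Hyp G) (N : Subgroup G) [N.Normal] :
    Hyp (G ⧸ N) := by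
  intro p hp Q
  have := Fact.mk hp
  have hs := QuotientGroup.mk'_surjective N
  obtain ⟨P, rfl⟩ := Sylow.mapSurjective_surjective hs p Q
  rcases h p hp P with hc | ⟨hn, hM⟩
  · left
    exact isCyclic_of_surjective _ (MonoidHom.subgroupMap_surjective (QuotientGroup.mk' N)
      (P : Subgroup G))
  right
  refine ⟨by rw [Sylow.coe_mapSurjective]; exact hn.map _ hs, fun M hMm => ?_⟩
  rw [Sylow.coe_mapSurjective] at hMm
  set f := QuotientGroup.mk' N with hf
  have hmap : (M.comap f ⊓ P).map f = M := by
    ext z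
    constructor
    · rintro ⟨y, hy, rfl⟩
      exact hy.1
    · intro hz
      obtain ⟨y, hy, rfl⟩ := hMm.1.le hz
      exact ⟨y, ⟨hz, hy⟩, rfl⟩
  rw [← hmap]
  refine (hM _ ⟨?_, ?_⟩).map _ hs
  · refine lt_of_le_of_ne inf_le_right fun e => ?_
    rw [e] at hmap
    exact hMm.1.ne hmap.symm
  · intro K hK hKP
    have h1 : M ≤ K.map f := by
      rw [← hmap]
      exact Subgroup.map_mono hK.le
    have h2 : M < K.map f := by
      refine lt_of_le_of_ne h1 fun e => hK.not_ge (le_inf ?_ hKP)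
      rw [e]
      exact Subgroup.le_comap_map _ _
    have h3 := hMm.2 _ h2 (Subgroup.map_mono hKP)
    refine le_antisymm hKP fun y hy => ?_
    have : f y ∈ K.map f := h3.ge ⟨y, hy, rfl⟩
    obtain ⟨k, hk, hky⟩ := this
    have h4 : k⁻¹ * y ∈ M.comap f ⊓ (P : Subgroup G) := by
      refine ⟨?_, (P : Subgroup G).mul_mem ((P : Subgroup G).inv_mem (hKP hk)) hy⟩
      change f (k⁻¹ * y) ∈ M
      rw [map_mul, map_inv, hky, inv_mul_cancel]
      exact M.one_mem
    have := K.mul_mem hk (hK.le h4)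
    simpa using this

theorem ss_of_quot {G : Type*} [Group G] (N : Subgroup G) [N.Normal] (x : G)
    (hx : N = Subgroup.zpowers x) (h : IsSupersolvable (G ⧸ N)) : IsSupersolvable G := by
  obtain ⟨n, c, h0, hn, hle, hnor, hcyc⟩ := h
  have hs := QuotientGroup.mk'_surjective N
  refine ⟨n + 1, fun i => Nat.casesOn i ⊥ (fun j => (c j).comap (QuotientGroup.mk' N)), rfl,
    ?_, ?_, ?_, ?_⟩
  · simp [hn]
  · rintro (_ | i)
    · exact bot_le
    · exact Subgroup.comap_mono (hle i)
  · rintro (_ | i)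
    · exact (inferInstance : (⊥ : Subgroup G).Normal)
    · exact (hnor i).comap _
  · rintro (_ | i)
    · refine ⟨x, ?_, ?_⟩
      · simp only [h0, MonoidHom.comap_bot, QuotientGroup.ker_mk']
        rw [hx]
        exact Subgroup.mem_zpowers x
      · simp only [h0, MonoidHom.comap_bot, QuotientGroup.ker_mk']
        exact (bot_sup_eq _).trans hx.symm
    · obtain ⟨z, hz, he⟩ := hcyc i
      obtain ⟨y, rfl⟩ := hs z
      refine ⟨y, hz, ?_⟩
      simp only
      rw [← he, ← MonoidHom.map_zpowers, ← Subgroup.comap_sup_eq _ _ _ hs,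
        Subgroup.comap_map_eq, QuotientGroup.ker_mk', sup_comm (Subgroup.zpowers y) N,
        ← sup_assoc]
      congr 1
      rw [eq_comm, sup_eq_left]
      intro w hw
      change QuotientGroup.mk' N w ∈ c i
      rw [(QuotientGroup.eq_one_iff w).2 hw |> (fun h => (h : QuotientGroup.mk' N w = 1))]
      exact one_mem _

theorem eig {A : Type*} [CommGroup A] [Finite A] [Nontrivial A] (p : ℕ) [Fact p.Prime]
    (hA : ∀ a : A, a ^ p = 1) (f : A →* A) (hf : ∀ a, f^[p] a = f a) :
    ∃ v : A, v ≠ 1 ∧ ∃ k : ℕ, f v = v ^ k := by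
  let : Module (ZMod p) (Additive A) := AddCommGroup.zmodModule (n := p) (fun x => hA x.toMul)
  let F : Module.End (ZMod p) (Additive A) := AddMonoidHom.toZModLinearMap p f.toAdditive
  have hF : F ^ p = F := by
    ext x
    rw [Module.End.pow_apply]
    exact hf x.toMul
  have hd : minpoly (ZMod p) F ∣ (Polynomial.X ^ p - Polynomial.X : Polynomial (ZMod p)) := by
    apply minpoly.dvd
    simp [hF]
  have hne : (Polynomial.X ^ p - Polynomial.X : Polynomial (ZMod p)) ≠ 0 :=
    FiniteField.X_pow_card_sub_X_ne_zero _ (Fact.out : p.Prime).one_lt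
  have hsp := (GaloisField.splits_zmod_X_pow_sub_X p).of_dvd hne hd
  have hFint : IsIntegral (ZMod p) F := Algebra.IsIntegral.isIntegral F
  obtain ⟨a, ha⟩ := hsp.exists_eval_eq_zero (minpoly.degree_pos hFint).ne'
  obtain ⟨v, hv⟩ := (Module.End.hasEigenvalue_of_isRoot ha).exists_hasEigenvector
  refine ⟨v.toMul, fun e => hv.2 e, a.val, ?_⟩
  have h1 : F v = a • v := hv.apply_eq_smul
  have h2 : a • v = a.val • v := by
    conv_lhs => rw [← ZMod.natCast_zmod_val a]
    rw [Nat.cast_smul_eq_nsmul]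
  exact h1.trans h2

theorem exists_char {G : Type*} [Group G] [Finite G] (H : Subgroup G) [H.Normal] (p : ℕ)
    [Fact p.Prime] (hH : Nat.card H = p) :
    ∃ φ : G →* (ZMod p)ˣ, ∀ g, φ g = 1 → ∀ y ∈ H, g * y * g⁻¹ = y := by
  subst hH
  have : IsCyclic H := isCyclic_of_prime_card (p := Nat.card H) rfl
  refine ⟨(IsCyclic.mulAutMulEquiv H).toMonoidHom.comp MulAut.conjNormal, fun g hg y hy => ?_⟩
  have h1 : (MulAut.conjNormal g : MulAut H) = 1 := by
    apply (IsCyclic.mulAutMulEquiv H).injective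
    rw [map_one]
    exact hg
  have h2 := MulAut.conjNormal_apply (H := H) g ⟨y, hy⟩
  rw [h1] at h2
  exact h2.symm

theorem char_quot {G : Type*} [Group G] [Finite G] {p : ℕ} [Fact p.Prime] {M P : Subgroup G}
    (hP : IsPGroup p P) (hPn : P.Normal) (h : IsMaximalSubgroupOf M P) (hM : M.Normal) :
    ∃ φ : G →* (ZMod p)ˣ, ∀ g, φ g = 1 → ∀ y ∈ P, g * y * g⁻¹ * y⁻¹ ∈ M := by
  have hs := QuotientGroup.mk'_surjective M
  have := hPn.map _ hs
  have hc : Nat.card (P.map (QuotientGroup.mk' M)) = p := by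
    have h1 := Subgroup.relIndex_ker P (QuotientGroup.mk' M)
    rw [QuotientGroup.ker_mk'] at h1
    rw [← h1]
    have h2 : Nat.card (M.subgroupOf P) * M.relIndex P = Nat.card P :=
      (M.subgroupOf P).card_mul_index
    rw [max_card hP h, Nat.card_congr (Subgroup.subgroupOfEquivOfLe h.1.le).toEquiv] at h2
    exact Nat.eq_of_mul_eq_mul_left Nat.card_pos h2
  obtain ⟨φ, hφ⟩ := exists_char (P.map (QuotientGroup.mk' M)) p hc
  refine ⟨φ.comp (QuotientGroup.mk' M), fun g hg y hy => ?_⟩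
  have := hφ _ hg _ ⟨y, hy, rfl⟩
  rw [← QuotientGroup.eq_one_iff]
  simp only [QuotientGroup.mk'_apply] at this
  simp only [QuotientGroup.mk_mul, QuotientGroup.mk_inv, this, mul_inv_cancel]

/-- A `q`-subgroup acting trivially on all `P / M` centralizes the `p`-group `P`. -/
theorem coprime_cent {G : Type*} [Group G] [Finite G] {p q : ℕ} [Fact p.Prime] [Fact q.Prime]
    (hqp : q ≠ p) {P Q : Subgroup G} (hP : IsPGroup p P) (hQ : IsPGroup q Q)
    (h : ∀ M, IsMaximalSubgroupOf M P → ∀ g ∈ Q, ∀ y ∈ P, g * y * g⁻¹ * y⁻¹ ∈ M)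
    (hM : ∀ M, IsMaximalSubgroupOf M P → M.Normal) :
    P ≤ Subgroup.centralizer Q := by
  by_contra hcon
  have hlt : P ⊓ Subgroup.centralizer Q < P :=
    lt_of_le_of_ne inf_le_left fun e => hcon (by rw [← e]; exact inf_le_right)
  obtain ⟨M, hmax, hle⟩ := exists_max hlt
  have hMn := hM M hmax
  obtain ⟨y, hyP, hyM⟩ := Set.exists_of_ssubset hmax.1
  -- Q acts on the coset M y
  let S := {z : G // z * y⁻¹ ∈ M}
  let act : MulAction Q S :=
    { smul := fun g z => ⟨g * z.1 * (g : G)⁻¹, by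
        have h1 := hMn.conj_mem _ z.2 (g : G)
        have h2 := M.mul_mem h1 (h M hmax g g.2 y hyP)
        have e : (g : G) * z.1 * (g : G)⁻¹ * y⁻¹
          = g * (z.1 * y⁻¹) * (g : G)⁻¹ * (g * y * (g : G)⁻¹ * y⁻¹) := by group
        rw [e]
        exact h2⟩
      one_smul := fun z => Subtype.ext (by
        change ((1 : Q) : G) * z.1 * ((1 : Q) : G)⁻¹ = z.1
        simp)
      mul_smul := fun a b z => Subtype.ext (by
        change ((a * b : Q) : G) * z.1 * ((a * b : Q) : G)⁻¹
          = a * (b * z.1 * (b : G)⁻¹) * (a : G)⁻¹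
        rw [Subgroup.coe_mul]
        group) }
  have hcard : Nat.card S = Nat.card M := by
    refine Nat.card_congr
      { toFun := fun z => ⟨z.1 * y⁻¹, z.2⟩
        invFun := fun m => ⟨m.1 * y, by simp⟩
        left_inv := fun z => by simp
        right_inv := fun m => by simp }
  have hnd : ¬ q ∣ Nat.card S := by
    rw [hcard]
    obtain ⟨n, hn⟩ := IsPGroup.iff_card.1 (hP.to_le hmax.1.le)
    rw [hn]
    intro hd
    exact hqp ((Nat.prime_dvd_prime_iff_eq Fact.out Fact.out).1
      ((Fact.out : q.Prime).dvd_of_dvd_pow hd))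
  obtain ⟨z, hz⟩ := hQ.nonempty_fixed_point_of_prime_not_dvd_card S hnd
  have hzM : z.1 ∈ M := by
    apply hle
    refine ⟨?_, ?_⟩
    · have := P.mul_mem (hmax.1.le z.2) hyP
      simpa using this
    · refine Subgroup.mem_centralizer_iff.2 ?_
      intro g hg
      have h1 : g * z.1 * g⁻¹ = z.1 := congrArg Subtype.val (hz ⟨g, hg⟩)
      exact mul_inv_eq_iff_eq_mul.1 h1
  apply hyM
  have := M.mul_mem (M.inv_mem z.2) hzM
  simpa using this

theorem exists_cyclic_of_noncyclic {G : Type*} [Group G] [Finite G] {p : ℕ} [Fact p.Prime]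
    (P : Sylow p G) (hPc : ¬ IsCyclic P) (hPn : (P : Subgroup G).Normal)
    (hM : ∀ M : Subgroup G, IsMaximalSubgroupOf M P → M.Normal) :
    ∃ x : G, x ≠ 1 ∧ (Subgroup.zpowers x).Normal := by
  -- the elements that act trivially on all the `P / M`
  let K : Subgroup G :=
    { carrier := {g | ∀ M, IsMaximalSubgroupOf M P → ∀ y ∈ P, g * y * g⁻¹ * y⁻¹ ∈ M}
      mul_mem' := by
        intro a b ha hb M hm y hy
        have h1 := ha M hm _ (hPn.conj_mem y hy b)
        have h2 := hb M hm y hy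
        have := M.mul_mem h1 h2
        have e : a * b * y * (a * b)⁻¹ * y⁻¹
          = a * (b * y * b⁻¹) * a⁻¹ * (b * y * b⁻¹)⁻¹ * (b * y * b⁻¹ * y⁻¹) := by group
        rw [e]
        exact this
      one_mem' := by
        intro M hm y hy
        simp
      inv_mem' := by
        intro a ha M hm y hy
        have h1 := ha M hm _ (hPn.conj_mem y hy a⁻¹)
        have := M.inv_mem h1
        have e : a⁻¹ * y * a⁻¹⁻¹ * y⁻¹
          = (a * (a⁻¹ * y * a⁻¹⁻¹) * a⁻¹ * (a⁻¹ * y * a⁻¹⁻¹)⁻¹)⁻¹ := by group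
        rw [e]
        exact this }
  have hKmem : ∀ g : G, (∀ φ : G →* (ZMod p)ˣ, φ g = 1) → g ∈ K := by
    intro g hg M hm y hy
    obtain ⟨φ, hφ⟩ := char_quot P.2 hPn hm (hM M hm)
    exact hφ g (hg φ) y hy
  have hK1 : ∀ x : G, x⁻¹ * x ^ p ∈ K := by
    intro x
    apply hKmem
    intro φ
    have := ZMod.units_pow_card_sub_one_eq_one p (φ x)
    have e : p = (p - 1) + 1 := (Nat.succ_pred_prime Fact.out).symm
    rw [map_mul, map_inv, map_pow]
    have h2 : φ x ^ p = φ x := by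
      have h3 := pow_succ (φ x) (p - 1)
      rwa [← e, this, one_mul] at h3
    rw [h2, inv_mul_cancel]
  have hK2 : ∀ x z : G, (z * x)⁻¹ * (x * z) ∈ K := by
    intro x z
    apply hKmem
    intro φ
    simp only [map_mul, map_inv]
    rw [mul_comm (φ z), inv_mul_cancel]
  -- central elements of exponent p
  let W : Subgroup G :=
    { carrier := {n | n ∈ P ∧ n ^ p = 1 ∧ ∀ y ∈ P, n * y = y * n}
      mul_mem' := by
        rintro a b ⟨ha, ha1, ha2⟩ ⟨hb, hb1, hb2⟩
        refine ⟨mul_mem ha hb, ?_, fun y hy => ?_⟩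
        · rw [Commute.mul_pow (ha2 b hb), ha1, hb1, one_mul]
        · rw [mul_assoc, hb2 y hy, ← mul_assoc, ha2 y hy, mul_assoc]
      one_mem' := ⟨one_mem P, one_pow _, fun y _ => by simp⟩
      inv_mem' := by
        rintro a ⟨ha, ha1, ha2⟩
        refine ⟨inv_mem ha, by rw [inv_pow, ha1, inv_one], fun y hy => ?_⟩
        exact (Commute.inv_left (ha2 y hy)) }
  have hWn : W.Normal := by
    constructor
    rintro n ⟨hn, hn1, hn2⟩ g
    refine ⟨hPn.conj_mem n hn g, by rw [conj_pow, hn1]; simp, fun y hy => ?_⟩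
    have h1 := hn2 (g⁻¹ * y * g) (by have := hPn.conj_mem y hy g⁻¹; rwa [inv_inv] at this)
    calc g * n * g⁻¹ * y = g * (n * (g⁻¹ * y * g)) * g⁻¹ := by group
      _ = g * ((g⁻¹ * y * g) * n) * g⁻¹ := by rw [h1]
      _ = y * (g * n * g⁻¹) := by group
  have hWb : W ≠ ⊥ := by
    have : Nontrivial P := by
      by_contra hcon
      rw [not_nontrivial_iff_subsingleton] at hcon
      exact hPc inferInstance
    have hcn := P.2.center_nontrivial
    obtain ⟨k, hk0, hk⟩ := (IsPGroup.nontrivial_iff_card (P.2.to_subgroup (Subgroup.center P))).1 hcn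
    obtain ⟨c, hc⟩ := exists_prime_orderOf_dvd_card' (G := Subgroup.center P) p
      (hk ▸ dvd_pow_self p hk0.ne')
    intro hW
    have : ((c : P) : G) ∈ W := by
      refine ⟨c.1.2, ?_, fun y hy => ?_⟩
      · have := pow_orderOf_eq_one c
        rw [hc] at this
        exact_mod_cast congrArg (fun t : Subgroup.center P => ((t : P) : G)) this
      · have := Subgroup.mem_center_iff.1 c.2 ⟨y, hy⟩
        exact (congrArg Subtype.val this).symm
    rw [hW, Subgroup.mem_bot] at this
    have hc1 : c = 1 := Subtype.ext (Subtype.ext this)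
    rw [hc1, orderOf_one] at hc
    exact (Fact.out : p.Prime).one_lt.ne hc
  obtain ⟨N, ⟨hNn, hNb, hNW⟩, hmin⟩ := Set.Finite.exists_minimalFor id
    {N : Subgroup G | N.Normal ∧ N ≠ ⊥ ∧ N ≤ W} (Set.toFinite _) ⟨W, hWn, hWb, le_rfl⟩
  have hNmin : ∀ E : Subgroup G, E.Normal → E ≠ ⊥ → E ≤ N → N ≤ E := fun E h1 h2 h3 =>
    hmin ⟨h1, h2, h3.trans hNW⟩ h3
  have hKN : K ≤ Subgroup.centralizer N := by
    rw [← Subgroup.subgroupOf_eq_top]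
    apply eq_top_of_sylow
    intro q hq
    have := Fact.mk hq
    obtain ⟨Q⟩ : Nonempty (Sylow q K) := inferInstance
    refine ⟨Q, fun g hg => ?_⟩
    rw [Subgroup.mem_subgroupOf, Subgroup.mem_centralizer_iff]
    intro n hn
    have hnW := hNW hn
    have hQ : IsPGroup q ((Q : Subgroup K).map K.subtype) := Q.2.map _
    have hgQ : (g : G) ∈ (Q : Subgroup K).map K.subtype := ⟨g, hg, rfl⟩
    by_cases hqp : q = p
    · subst hqp
      obtain ⟨P', hP'⟩ := hQ.exists_le_sylow
      have e : P' = P := by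
        have : Subsingleton (Sylow q G) := (Sylow.unique_of_normal P hPn).instSubsingleton
        exact Subsingleton.elim _ _
      subst e
      exact hnW.2.2 g (hP' hgQ)
    · have := coprime_cent hqp P.2 hQ (by
        rintro M hm _ ⟨k, hk, rfl⟩ y hy
        exact k.2 M hm y hy) hM
      exact (Subgroup.mem_centralizer_iff.1 (this hnW.1) g hgQ).symm
  have hcomm : ∀ g ∈ K, ∀ n ∈ N, g * n * g⁻¹ = n := by
    intro g hg n hn
    rw [mul_inv_eq_iff_eq_mul]
    exact (Subgroup.mem_centralizer_iff.1 (hKN hg) n hn).symm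
  let cg : CommGroup N :=
    { (inferInstance : Group N) with
      mul_comm := fun a b => Subtype.ext ((hNW a.2).2.2 b (hNW b.2).1) }
  have hNt : Nontrivial N := (Subgroup.nontrivial_iff_ne_bot N).2 hNb
  have hpow : ∀ x : G, ∃ k : ℕ, ∀ n ∈ N, x * n * x⁻¹ = n ^ k := by
    intro x
    have hiter : ∀ (j : ℕ) (a : N),
        (((MulAut.conjNormal x : MulAut N).toMonoidHom)^[j] a : G) = x ^ j * a * (x ^ j)⁻¹ := by
      intro j
      induction j with
      | zero => intro a; simp
      | succ j ih =>
        intro a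
        rw [Function.iterate_succ_apply, ih]
        have : (((MulAut.conjNormal x : MulAut N).toMonoidHom a : N) : G) = x * a * x⁻¹ :=
          MulAut.conjNormal_apply x a
        rw [this, pow_succ]
        group
    obtain ⟨v, hv, k, hvk⟩ := eig (A := N) p (fun a => Subtype.ext (hNW a.2).2.1)
      (MulAut.conjNormal x : MulAut N).toMonoidHom (by
        intro a
        apply Subtype.ext
        rw [hiter]
        have h1 := hcomm _ (hK1 x) a a.2
        have h2 := hiter 1 a
        rw [Function.iterate_one, pow_one] at h2
        rw [h2]
        calc x ^ p * (a : G) * (x ^ p)⁻¹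
            = x * ((x⁻¹ * x ^ p) * a * (x⁻¹ * x ^ p)⁻¹) * x⁻¹ := by group
          _ = _ := by rw [h1])
    refine ⟨k, ?_⟩
    have hvk' : x * (v : G) * x⁻¹ = (v : G) ^ k := by
      have h2 := hiter 1 v
      rw [Function.iterate_one, pow_one, hvk] at h2
      rw [← h2]
      rfl
    let E : Subgroup G :=
      { carrier := {n | n ∈ N ∧ x * n * x⁻¹ = n ^ k}
        mul_mem' := by
          rintro a b ⟨ha, ha1⟩ ⟨hb, hb1⟩
          refine ⟨N.mul_mem ha hb, ?_⟩
          rw [Commute.mul_pow ((hNW ha).2.2 b (hNW hb).1), ← ha1, ← hb1]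
          group
        one_mem' := ⟨N.one_mem, by simp⟩
        inv_mem' := by
          rintro a ⟨ha, ha1⟩
          refine ⟨N.inv_mem ha, ?_⟩
          rw [inv_pow, ← ha1]
          group }
    have hEn : E.Normal := by
      constructor
      rintro n ⟨hn, hn1⟩ z
      refine ⟨hNn.conj_mem n hn z, ?_⟩
      have h1 := hcomm _ (hK2 x z) n hn
      rw [conj_pow, ← hn1]
      calc x * (z * n * z⁻¹) * x⁻¹
          = z * x * ((z * x)⁻¹ * (x * z) * n * ((z * x)⁻¹ * (x * z))⁻¹) * (z * x)⁻¹ := by group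
        _ = z * x * n * (z * x)⁻¹ := by rw [h1]
        _ = z * (x * n * x⁻¹) * z⁻¹ := by group
    have hEb : E ≠ ⊥ := by
      intro e
      have : (v : G) ∈ E := ⟨v.2, hvk'⟩
      rw [e, Subgroup.mem_bot] at this
      exact hv (Subtype.ext this)
    exact fun n hn => (hNmin E hEn hEb (fun n hn => hn.1) hn).2
  obtain ⟨⟨v, hv⟩, hv1⟩ := Subgroup.ne_bot_iff_exists_ne_one.1 hNb
  refine ⟨v, fun e => hv1 (Subtype.ext e), ⟨?_⟩⟩
  intro n hn g
  obtain ⟨k, hk⟩ := hpow g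
  rw [hk n ((Subgroup.zpowers_le.2 hv) hn)]
  exact Subgroup.pow_mem _ hn k

theorem exists_cyclic {G : Type*} [Group G] [Finite G] [Nontrivial G] (h : Hyp G) :
    ∃ x : G, x ≠ 1 ∧ (Subgroup.zpowers x).Normal := by
  by_cases hz : IsZGroup G
  · by_cases hc : commutator G = ⊥
    · obtain ⟨x, hx⟩ := exists_ne (1 : G)
      refine ⟨x, hx, ⟨fun n hn g => ?_⟩⟩
      rw [commutator_eq_bot_iff_center_eq_top] at hc
      have : n ∈ Subgroup.center G := hc ▸ Subgroup.mem_top n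
      rw [Subgroup.mem_center_iff.1 this g]
      simpa using hn
    · obtain ⟨x, hx⟩ := (Subgroup.isCyclic_iff_exists_zpowers_eq_top (commutator G)).1
        (IsZGroup.isCyclic_commutator G)
      refine ⟨x, ?_, hx ▸ inferInstance⟩
      rintro rfl
      exact hc (by rw [← hx, Subgroup.zpowers_one_eq_bot])
  · rw [isZGroup_iff] at hz
    push Not at hz
    obtain ⟨p, hp, P, hP⟩ := hz
    have := Fact.mk hp
    rcases h p hp P with h1 | ⟨h1, h2⟩
    · exact absurd h1 hP
    · exact exists_cyclic_of_noncyclic P hP h1 h2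

theorem main.{u} (n : ℕ) : ∀ (G : Type u) [Group G] [Finite G], Nat.card G = n → Hyp G →
    IsSupersolvable G := by
  induction n using Nat.strong_induction_on with
  | _ n ih =>
    intro G _ _ hn h
    rcases subsingleton_or_nontrivial G with hs | hs
    · exact ⟨0, fun _ => ⊥, rfl, Subsingleton.elim _ _, fun _ => le_rfl, fun _ => inferInstance,
        fun _ => ⟨1, one_mem _, by simp⟩⟩
    · obtain ⟨x, hx, hN⟩ := exists_cyclic h
      refine ss_of_quot (Subgroup.zpowers x) x rfl (ih _ ?_ _ rfl (hyp_quot h _))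
      rw [← hn, Subgroup.card_eq_card_quotient_mul_card_subgroup (Subgroup.zpowers x)]
      have : 1 < Nat.card (Subgroup.zpowers x) := by
        rw [Subgroup.one_lt_card_iff_ne_bot]
        simpa using hx
      exact lt_mul_of_one_lt_right Nat.card_pos this

end SQ

theorem stmt14 {G : Type*} [Group G] [Fintype G]
    (h : ∀ p : ℕ, p.Prime → p ∣ Nat.card G → ∀ P : Sylow p G,
      ¬ IsCyclic (P : Subgroup G) →
      ∀ M : Subgroup G, IsMaximalSubgroupOf M (P : Subgroup G) → M.IsSQuasinormal) :
    IsSupersolvable G := by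
  exact SQ.main _ G rfl (SQ.hyp_of h)
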